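/- Let T̂ = P·T as above and r ≥ 1. If w(x) = 0 and w(y) = 1, then {j : (T̂)^r(x,j) > 0} ⊆ {j : (T̂)^r(y,j) > 0}. -/

import Mathlib

open Matrix Finset

/-- Lower bidiagonal 0-1 matrix: T(i,j)=1 iff i=j or i=j+1. -/
def Tmat (n : ℕ) : Matrix (Fin n) (Fin n) ℕ :=
  Matrix.of fun i j => if (i : ℕ) = (j : ℕ) ∨ (i : ℕ) = (j : ℕ) + 1 then 1 else 0

/-- Permutation matrix of w: P(i,j)=1 iff j = w(i). -/
def Pmat {n : ℕ} (w : Fin n → Fin n) : Matrix (Fin n) (Fin n) ℕ :=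
  Matrix.of fun i j => if j = w i then 1 else 0

/-- T̂ = P · T. -/
def That {n : ℕ} (w : Fin n → Fin n) : Matrix (Fin n) (Fin n) ℕ :=
  Pmat w * Tmat n

theorem stmt_3 (n : ℕ) (hn : 1 ≤ n) (w : Fin n → Fin n) (hw : Function.Bijective w)
    (r : ℕ) (hr : 1 ≤ r) (x y : Fin n)
    (hx : (w x : ℕ) = 0) (hy : (w y : ℕ) = 1) :
    {j : Fin n | 0 < (That w ^ r) x j} ⊆ {j : Fin n | 0 < (That w ^ r) y j} := by
  have key : ∀ i j, That w i j = Tmat n (w i) j := by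
    intro i j
    simp [That, Pmat, Matrix.mul_apply]
  have hle : ∀ k, That w x k ≤ That w y k := by
    intro k
    rw [key, key]
    simp only [Tmat, Matrix.of_apply, hx, hy]
    by_cases h : (k : ℕ) = 0
    · simp [h]
    · have h1 : ¬ (0 = (k : ℕ) ∨ 0 = (k : ℕ) + 1) := by omega
      rw [if_neg h1]
      exact Nat.zero_le _
  obtain ⟨s, rfl⟩ : ∃ s, r = s + 1 := ⟨r - 1, by omega⟩
  intro j hj
  simp only [Set.mem_ofPred_eq, pow_succ', Matrix.mul_apply] at hj ⊢
  exact lt_of_lt_of_le hj (Finset.sum_le_sum fun k _ => Nat.mul_le_mul_right _ (hle k))
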